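/- Let m ≥ 3, n = (q^m−1)/(q−1) ≥ 6, and let T be the support of any codeword of Hamming weight 3 in the Hamming code H_{(q,m)}. Then the shortened code (H_{(q,m)}^⊥)_T of the Simplex code H_{(q,m)}^⊥ is an [n−3, m−2, q^{m−1}] code over GF(q). -/

import Mathlib

open Finset

section Defs

variable {F : Type} [Field F]

/-- The dual of a linear code `C ⊆ F^ι` w.r.t. the standard inner product. -/
def dualCode {ι : Type} [Fintype ι] (C : Submodule F (ι → F)) :
    Submodule F (ι → F) where
  carrier := {x | ∀ c ∈ C, ∑ i, x i * c i = 0}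
  add_mem' := by
    intro a b ha hb c hc
    simp only [Set.mem_setOf_eq] at ha hb ⊢
    simp only [Pi.add_apply, add_mul, Finset.sum_add_distrib, ha c hc, hb c hc, add_zero]
  zero_mem' := by
    intro c hc
    simp
  smul_mem' := by
    intro r a ha c hc
    simp only [Set.mem_setOf_eq] at ha ⊢
    simp only [Pi.smul_apply, smul_eq_mul, mul_assoc, ← Finset.mul_sum, ha c hc, mul_zero]

/-- The subcode of codewords vanishing on every coordinate in `T`. -/
def zeroOn {ι : Type} (T : Finset ι) : Submodule F (ι → F) where
  carrier := {x | ∀ i ∈ T, x i = 0}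
  add_mem' := by
    intro a b ha hb i hi
    simp only [Set.mem_setOf_eq] at ha hb
    simp [Pi.add_apply, ha i hi, hb i hi]
  zero_mem' := by intro i _; simp
  smul_mem' := by
    intro r a ha i hi
    simp only [Set.mem_setOf_eq] at ha
    simp [Pi.smul_apply, ha i hi]

/-- Deleting the coordinates in `T`. -/
def restrictTo {ι : Type} (T : Finset ι) : (ι → F) →ₗ[F] ({i : ι // i ∉ T} → F) :=
  LinearMap.funLeft F F Subtype.val

/-- The punctured code `C^T`: delete the coordinates in `T` from every codeword. -/
def puncturedCode {ι : Type} (C : Submodule F (ι → F)) (T : Finset ι) :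
    Submodule F ({i : ι // i ∉ T} → F) :=
  C.map (restrictTo T)

/-- The shortened code `C_T`: take the codewords vanishing on `T`, then delete `T`. -/
def shortenedCode {ι : Type} (C : Submodule F (ι → F)) (T : Finset ι) :
    Submodule F ({i : ι // i ∉ T} → F) :=
  (C ⊓ zeroOn T).map (restrictTo T)

/-- The code `C` has minimum distance (exactly) `d`. -/
def IsMinDist {ι : Type} [Fintype ι] [DecidableEq F] (C : Submodule F (ι → F)) (d : ℕ) : Prop :=
  (∃ c ∈ C, c ≠ 0 ∧ hammingNorm c = d) ∧ ∀ c ∈ C, c ≠ 0 → d ≤ hammingNorm c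

/-- `A_k(C)`: the number of codewords of Hamming weight `k` in `C`. -/
noncomputable def weightCount {ι : Type} [Fintype ι] [DecidableEq F]
    (C : Submodule F (ι → F)) (k : ℕ) : ℕ :=
  Nat.card {c : ι → F // c ∈ C ∧ hammingNorm c = k}

/-- A monomial transformation: permute the coordinates and scale each coordinate. -/
def monomialMap {ι κ : Type} (σ : ι ≃ κ) (u : κ → F) : (ι → F) →ₗ[F] (κ → F) where
  toFun x := fun j => u j * x (σ.symm j)
  map_add' a b := by
    funext j
    simp [Pi.add_apply, mul_add]
  map_smul' r a := by
    funext j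
    simp only [Pi.smul_apply, smul_eq_mul, RingHom.id_apply]
    ring

/-- Monomial equivalence of linear codes. -/
def MonomiallyEquiv {ι κ : Type} (C : Submodule F (ι → F)) (D : Submodule F (κ → F)) : Prop :=
  ∃ (σ : ι ≃ κ) (u : κ → F), (∀ j, u j ≠ 0) ∧ D = C.map (monomialMap σ u)

/-- The syndrome map attached to a parity-check matrix with columns `v i`. -/
def checkMap {m n : ℕ} (v : Fin n → (Fin m → F)) : (Fin n → F) →ₗ[F] (Fin m → F) where
  toFun x := fun j => ∑ i, x i * v i j
  map_add' a b := by
    funext j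
    simp [Pi.add_apply, add_mul, Finset.sum_add_distrib]
  map_smul' r a := by
    funext j
    simp [Pi.smul_apply, Finset.mul_sum, mul_assoc]

/-- `v` lists exactly one nonzero vector from each one-dimensional subspace of `F^m`. -/
def IsHammingMatrix {m n : ℕ} (v : Fin n → (Fin m → F)) : Prop :=
  (∀ i, v i ≠ 0) ∧ ∀ w : Fin m → F, w ≠ 0 → ∃! i : Fin n, ∃ c : F, w = c • v i

/-- The Hamming code attached to a parity-check matrix whose columns are the `v i`. -/
def hammingCode {m n : ℕ} (v : Fin n → (Fin m → F)) : Submodule F (Fin n → F) :=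
  LinearMap.ker (checkMap v)

/-- The Simplex code: the dual of the Hamming code. -/
def simplexCode {m n : ℕ} (v : Fin n → (Fin m → F)) : Submodule F (Fin n → F) :=
  dualCode (hammingCode v)

end Defs

section Helpers

variable {F : Type} [Field F]

def evMap {m n : ℕ} (v : Fin n → (Fin m → F)) :
    Module.Dual F (Fin m → F) →ₗ[F] (Fin n → F) where
  toFun φ := fun i => φ (v i)
  map_add' a b := by funext i; simp
  map_smul' r a := by funext i; simp

lemma checkMap_eq {m n : ℕ} (v : Fin n → (Fin m → F)) (x : Fin n → F) :
    checkMap v x = ∑ i, x i • v i := by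
  funext j
  simp [checkMap, Finset.sum_apply]

lemma mem_simplex {m n : ℕ} (v : Fin n → (Fin m → F)) (x : Fin n → F) :
    x ∈ simplexCode v ↔ ∃ φ : Module.Dual F (Fin m → F), evMap v φ = x := by
  constructor
  · intro hx
    have hx' : ∀ c ∈ hammingCode v, ∑ i, x i * c i = 0 := hx
    let ψ : Module.Dual F (Fin n → F) := ∑ i, x i • LinearMap.proj i
    have hψ : ∀ y, ψ y = ∑ i, x i * y i := by intro y; simp [ψ]
    have h1 : ψ ∈ (LinearMap.ker (checkMap v)).dualAnnihilator := by
      rw [Submodule.mem_dualAnnihilator]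
      intro w hw
      rw [hψ]; exact hx' w hw
    rw [← LinearMap.range_dualMap_eq_dualAnnihilator_ker] at h1
    obtain ⟨φ, hφ⟩ := h1
    refine ⟨φ, ?_⟩
    funext i
    have h2 := LinearMap.congr_fun hφ (Pi.single i 1)
    rw [hψ, LinearMap.dualMap_apply, checkMap_eq] at h2
    simpa [Pi.single_apply, evMap] using h2
  · rintro ⟨φ, rfl⟩ c hc
    have hc' : checkMap v c = 0 := hc
    rw [checkMap_eq] at hc'
    have := congrArg φ hc'
    simpa [map_sum, evMap, mul_comm] using this

lemma ev_inj {m n : ℕ} (v : Fin n → (Fin m → F)) (hv : IsHammingMatrix v)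
    (φ : Module.Dual F (Fin m → F)) (h : ∀ i, φ (v i) = 0) : φ = 0 := by
  refine LinearMap.ext fun w => ?_
  by_cases hw : w = 0
  · simp [hw]
  · obtain ⟨i, ⟨c, hc⟩, -⟩ := hv.2 w hw
    simp [hc, h i]

lemma weight_eq [Fintype F] [DecidableEq F] {m n : ℕ} (v : Fin n → (Fin m → F))
    (hv : IsHammingMatrix v) (φ : Module.Dual F (Fin m → F)) (hφ : φ ≠ 0) :
    Nat.card {i // φ (v i) ≠ 0} = Fintype.card F ^ (m - 1) := by
  have hker : Nat.card {w // φ w = 0} = Fintype.card F ^ (m - 1) := by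
    have h1 : Module.finrank F (LinearMap.ker φ) = m - 1 := by
      have := LinearMap.finrank_range_add_finrank_ker φ
      have h2 : LinearMap.range φ = ⊤ := LinearMap.range_eq_top.2 (LinearMap.surjective hφ)
      rw [h2] at this
      simp at this
      omega
    have h3 := Module.natCard_eq_pow_finrank (K := F) (V := LinearMap.ker φ)
    rw [h1, Nat.card_eq_fintype_card (α := F)] at h3
    exact h3
  have hm : 1 ≤ m := by
    rcases Nat.eq_zero_or_pos m with h | h
    · subst h
      exact absurd (LinearMap.ext fun w => (congrArg φ (Subsingleton.elim w 0)).trans (map_zero φ)) hφ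
    · exact h
  have htot : Nat.card {w // φ w = 0} + Nat.card {w // φ w ≠ 0} = Fintype.card F ^ m := by
    have := Fintype.card_subtype_compl (fun w => φ w = 0)
    have h2 := Fintype.card_subtype_le (fun w => φ w = 0)
    simp only [Nat.card_eq_fintype_card]
    simp at this h2 ⊢
    omega
  have hbij : Nat.card ({i // φ (v i) ≠ 0} × Fˣ) = Nat.card {w // φ w ≠ 0} := by
    refine Nat.card_eq_of_bijective
      (fun p => ⟨(p.2 : F) • v p.1, by simpa using p.1.2⟩) ⟨?_, ?_⟩
    · rintro ⟨⟨i, hi⟩, u⟩ ⟨⟨j, hj⟩, t⟩ h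
      have h : (u : F) • v i = (t : F) • v j := congrArg Subtype.val h
      have hne : (u : F) • v i ≠ 0 := smul_ne_zero u.ne_zero (hv.1 i)
      have hij : i = j := (hv.2 _ hne).unique ⟨_, rfl⟩ ⟨_, h⟩
      subst hij
      have := smul_left_injective F (hv.1 i) h
      have := Units.ext this
      subst this
      rfl
    · rintro ⟨w, hw⟩
      have hw0 : w ≠ 0 := by rintro rfl; simp at hw
      obtain ⟨i, ⟨c, hc⟩, -⟩ := hv.2 w hw0
      have hc0 : c ≠ 0 := by rintro rfl; simp at hc; exact hw0 hc
      refine ⟨⟨⟨i, ?_⟩, Units.mk0 c hc0⟩, ?_⟩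
      · intro h; apply hw; simp [hc, h]
      · exact Subtype.ext hc.symm
  rw [Nat.card_prod, Nat.card_eq_fintype_card (α := Fˣ), Fintype.card_units] at hbij
  rw [hker, ← hbij] at htot
  have hq : 1 < Fintype.card F := Fintype.one_lt_card
  obtain ⟨k, rfl⟩ : ∃ k, m = k + 1 := ⟨m - 1, by omega⟩
  obtain ⟨r, hr⟩ : ∃ r, Fintype.card F = r + 1 := ⟨Fintype.card F - 1, by omega⟩
  rw [hr] at htot hq ⊢
  simp only [Nat.add_sub_cancel] at htot ⊢
  have hr0 : 0 < r := by omega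
  apply Nat.eq_of_mul_eq_mul_right hr0
  rw [pow_succ, mul_add, mul_one] at htot
  omega

lemma span_rank [DecidableEq F] {m n : ℕ} (v : Fin n → (Fin m → F)) (hv : IsHammingMatrix v)
    (c : Fin n → F) (hc : c ∈ hammingCode v)
    (T : Finset (Fin n)) (hT : ∀ i, i ∈ T ↔ c i ≠ 0) (h3 : T.card = 3) :
    Module.finrank F (Submodule.span F (v '' (T : Set (Fin n)))) = 2 := by
  obtain ⟨a, b, d, hab, had, hbd, rfl⟩ := Finset.card_eq_three.1 h3
  have hc' : checkMap v c = 0 := hc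
  rw [checkMap_eq] at hc'
  have hs : ∑ i ∈ ({a, b, d} : Finset (Fin n)), c i • v i = 0 := by
    rw [← hc']
    apply Finset.sum_subset (Finset.subset_univ _)
    intro i _ hi
    rw [hT] at hi
    simp only [not_not] at hi
    simp [hi]
  rw [Finset.sum_insert (by simp [hab, had]), Finset.sum_insert (by simp [hbd]),
    Finset.sum_singleton] at hs
  have hd : c d ≠ 0 := (hT d).1 (by simp)
  have hdm : v d = (-(c d)⁻¹ * c a) • v a + (-(c d)⁻¹ * c b) • v b := by
    have : c d • v d = -(c a • v a) - c b • v b := by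
      rw [← sub_eq_zero, ← hs]; abel
    calc v d = (c d)⁻¹ • (c d • v d) := by rw [smul_smul, inv_mul_cancel₀ hd, one_smul]
      _ = _ := by rw [this]; module
  have hli : LinearIndependent F ![v a, v b] := by
    rw [LinearIndependent.pair_iff' (hv.1 a)]
    intro t ht
    exact hab ((hv.2 (v b) (hv.1 b)).unique ⟨t, ht.symm⟩ ⟨1, by simp⟩)
  have hspan : Submodule.span F (v '' (({a, b, d} : Finset (Fin n)) : Set (Fin n)))
      = Submodule.span F (Set.range ![v a, v b]) := by
    apply le_antisymm
    · rw [Submodule.span_le]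
      rintro _ ⟨i, hi, rfl⟩
      have ha : v a ∈ Submodule.span F (Set.range ![v a, v b]) :=
        Submodule.subset_span ⟨0, rfl⟩
      have hb : v b ∈ Submodule.span F (Set.range ![v a, v b]) :=
        Submodule.subset_span ⟨1, rfl⟩
      simp only [Finset.coe_insert, Finset.coe_singleton, Set.mem_insert_iff,
        Set.mem_singleton_iff] at hi
      rcases hi with rfl | rfl | rfl
      · exact ha
      · exact hb
      · rw [hdm]
        exact Submodule.add_mem _ (Submodule.smul_mem _ _ ha) (Submodule.smul_mem _ _ hb)
    · apply Submodule.span_mono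
      rintro _ ⟨i, rfl⟩
      fin_cases i
      · exact ⟨a, by simp, rfl⟩
      · exact ⟨b, by simp, rfl⟩
  rw [hspan, finrank_span_eq_card hli]
  simp

end Helpers

/-- If `T` is the support of a codeword of weight `3` in the Hamming code `H_{(q,m)}`,
then the shortened Simplex code `(H_{(q,m)}^⊥)_T` is an `[n-3, m-2, q^{m-1}]` code. -/
theorem statement11 {F : Type} [Field F] [Fintype F] [DecidableEq F] {m n : ℕ}
    (hm : 3 ≤ m) (hq : n * (Fintype.card F - 1) = Fintype.card F ^ m - 1) (hn : 6 ≤ n)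
    (v : Fin n → (Fin m → F)) (hv : IsHammingMatrix v)
    (c : Fin n → F) (hc : c ∈ hammingCode v) (hwt : hammingNorm c = 3)
    (T : Finset (Fin n)) (hT : ∀ i, i ∈ T ↔ c i ≠ 0) :
    Nat.card {i : Fin n // i ∉ T} = n - 3 ∧
    Module.finrank F ↥(shortenedCode (simplexCode v) T) = m - 2 ∧
    IsMinDist (shortenedCode (simplexCode v) T) (Fintype.card F ^ (m - 1)) := by
  have h3 : T.card = 3 := by
    rw [← hwt, hammingNorm]
    congr 1
    ext i
    simp [hT]
  set W := (Submodule.span F (v '' (T : Set (Fin n)))).dualAnnihilator with hW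
  have memW : ∀ φ, φ ∈ W ↔ ∀ i ∈ T, φ (v i) = 0 := by
    intro φ
    rw [hW, Submodule.mem_dualAnnihilator]
    constructor
    · intro h i hi
      exact h _ (Submodule.subset_span ⟨i, hi, rfl⟩)
    · intro h
      have : Submodule.span F (v '' (T : Set (Fin n))) ≤ LinearMap.ker φ := by
        rw [Submodule.span_le]
        rintro _ ⟨i, hi, rfl⟩
        exact h i hi
      exact fun w hw => this hw
  have hrW : Module.finrank F W = m - 2 := by
    have h1 := Subspace.finrank_add_finrank_dualAnnihilator_eq
      (Submodule.span F (v '' (T : Set (Fin n))))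
    rw [span_rank v hv c hc T hT h3, Module.finrank_fin_fun] at h1
    have h1' : 2 + Module.finrank F W = m := h1
    omega
  have hS : shortenedCode (simplexCode v) T = W.map (restrictTo T ∘ₗ evMap v) := by
    ext y
    simp only [shortenedCode, Submodule.mem_map, Submodule.mem_inf, mem_simplex]
    constructor
    · rintro ⟨x, ⟨⟨φ, rfl⟩, h⟩, rfl⟩
      exact ⟨φ, (memW φ).2 h, rfl⟩
    · rintro ⟨φ, h, rfl⟩
      exact ⟨_, ⟨⟨φ, rfl⟩, (memW φ).1 h⟩, rfl⟩
  have hinj : ∀ φ ∈ W, (restrictTo T ∘ₗ evMap v) φ = 0 → φ = 0 := by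
    intro φ hφ h
    apply ev_inj v hv
    intro i
    by_cases hi : i ∈ T
    · exact (memW φ).1 hφ i hi
    · exact congrFun h ⟨i, hi⟩
  have hnorm : ∀ φ ∈ W, φ ≠ 0 →
      hammingNorm ((restrictTo T ∘ₗ evMap v) φ) = Fintype.card F ^ (m - 1) := by
    intro φ hφ h0
    rw [← weight_eq v hv φ h0, hammingNorm, ← Fintype.card_subtype, ← Nat.card_eq_fintype_card]
    refine Nat.card_eq_of_bijective (fun p => ⟨p.1.1, p.2⟩) ⟨?_, ?_⟩
    · intro p r h
      have h' : p.1.1 = r.1.1 := congrArg (fun z : {i // φ (v i) ≠ 0} => z.1) h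
      exact Subtype.ext (Subtype.ext h')
    · rintro ⟨i, hi⟩
      exact ⟨⟨⟨i, fun h => hi ((memW φ).1 hφ i h)⟩, hi⟩, rfl⟩
  have hfr : Module.finrank F ↥(shortenedCode (simplexCode v) T) = m - 2 := by
    rw [hS, ← hrW, ← LinearMap.range_domRestrict]
    apply LinearMap.finrank_range_of_inj
    refine (injective_iff_map_eq_zero _).2 ?_
    rintro ⟨φ, hφ⟩ h
    exact Subtype.ext (hinj φ hφ h)
  refine ⟨?_, hfr, ?_, ?_⟩
  · rw [Nat.card_eq_fintype_card, Fintype.card_subtype_compl]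
    simp [h3]
  · have hne : W ≠ ⊥ := by
      intro h
      rw [h, finrank_bot] at hrW
      omega
    obtain ⟨φ, hφ, h0⟩ := W.ne_bot_iff.1 hne
    refine ⟨(restrictTo T ∘ₗ evMap v) φ, ?_, fun h => h0 (hinj φ hφ h), hnorm φ hφ h0⟩
    rw [hS]
    exact Submodule.mem_map_of_mem hφ
  · intro x hx hx0
    rw [hS] at hx
    obtain ⟨φ, hφ, rfl⟩ := hx
    refine (hnorm φ hφ ?_).ge
    rintro rfl
    simp at hx0
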